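/- The topology τ_clopen on Erdős space 𝔈 generated by the collection of all clopen subsets of 𝔈 is not compatible with the group structure on 𝔈; that is, (𝔈, +) equipped with τ_clopen is not a topological group (addition fails to be continuous at the identity with respect to τ_clopen). -/

import Mathlib

noncomputable section

open scoped ENNReal

/-- The ambient Hilbert space `ℓ²` of real square-summable sequences. -/
abbrev ellTwo : Type := lp (fun _ : ℕ => ℝ) 2

/-- Erdős space `𝔈`: the additive subgroup of `ℓ²` consisting of the sequences
all of whose coordinates are rational. -/
def Erdos : AddSubgroup ellTwo where
  carrier := {x | ∀ k, ∃ q : ℚ, (x : ℕ → ℝ) k = (q : ℝ)}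
  add_mem' := by
    intro a b ha hb k
    obtain ⟨p, hp⟩ := ha k
    obtain ⟨q, hq⟩ := hb k
    exact ⟨p + q, by rw [lp.coeFn_add]; simp [hp, hq]⟩
  zero_mem' := fun k => ⟨0, by simp⟩
  neg_mem' := by
    intro a ha k
    obtain ⟨p, hp⟩ := ha k
    exact ⟨-p, by rw [lp.coeFn_neg]; simp [hp]⟩

/-- Erdős space as a type (with the subspace topology and norm inherited from `ℓ²`). -/
abbrev ErdosSpace : Type := ↥Erdos

/-- The coordinates of a point of Erdős space (indexed from `0`, so that the
coordinate `x_k` of the paper is `coords x (k-1)`). -/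
def coords (x : ErdosSpace) : ℕ → ℝ := ((x : ellTwo) : ℕ → ℝ)

/-- `mExists x α` says that `m_{x,α}` exists, i.e. some finite initial sum of squares
of coordinates exceeds `α` (here `m` counts how many initial coordinates are taken). -/
def mExists (x : ErdosSpace) (α : ℝ) : Prop :=
  ∃ m : ℕ, α < Real.sqrt (∑ k ∈ Finset.range m, (coords x k) ^ 2)

/-- `mIndex x α` is the least `m` such that `√(∑_{k<m} x_k²) > α` (and `0` if none exists);
this corresponds to `m_{x,α}` of the paper. -/
def mIndex (x : ErdosSpace) (α : ℝ) : ℕ :=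
  sInf {m : ℕ | α < Real.sqrt (∑ k ∈ Finset.range m, (coords x k) ^ 2)}

/-- The set `A_{α,β}`: those `x` for which either `m_{x,α}` exists and every coordinate
beyond the first `m_{x,α}` ones has absolute value `< β`, or `m_{x,α}` does not exist. -/
def A (α β : ℝ) : Set ErdosSpace :=
  {x | (mExists x α ∧ ∀ l, mIndex x α ≤ l → |coords x l| < β) ∨ ¬mExists x α}



open Filter Topology in
theorem aux_clopen_basis : @TopologicalSpace.IsTopologicalBasis ErdosSpace
    (TopologicalSpace.generateFrom {U : Set ErdosSpace | IsClopen U})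
    {U : Set ErdosSpace | IsClopen U} := by
  have h := @TopologicalSpace.isTopologicalBasis_of_subbasis_of_inter ErdosSpace
    (TopologicalSpace.generateFrom {U : Set ErdosSpace | IsClopen U})
    {U : Set ErdosSpace | IsClopen U} rfl (fun s hs t ht => IsClopen.inter hs ht)
  rwa [Set.insert_eq_of_mem] at h
  exact isClopen_univ

theorem aux_sum_le (x : ErdosSpace) (s : Finset ℕ) :
    ∑ k ∈ s, (coords x k) ^ 2 ≤ ‖x‖ ^ 2 := by
  have h := lp.sum_rpow_le_norm_rpow (p := 2) (by simp) (x : ellTwo) s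
  simpa [coords] using h

theorem aux_hasSum (x : ErdosSpace) : HasSum (fun k => (coords x k) ^ 2) (‖x‖ ^ 2) := by
  have h := lp.hasSum_norm (p := 2) (by simp) (x : ellTwo)
  simpa [coords] using h

theorem aux_exists (x : ErdosSpace) (a : ℝ) (h : a < ‖x‖ ^ 2) :
    ∃ m : ℕ, a < ∑ k ∈ Finset.range m, (coords x k) ^ 2 := by
  by_contra! hc
  exact absurd (le_of_tendsto' (aux_hasSum x).tendsto_sum_nat hc) (not_le.2 h)

theorem aux_coord_le (x : ErdosSpace) (k : ℕ) : |coords x k| ≤ ‖x‖ := by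
  have h := lp.norm_apply_le_norm (p := 2) (by simp) (x : ellTwo) k
  simpa [coords] using h

theorem aux_coords_sub (x y : ErdosSpace) (k : ℕ) :
    coords (x - y) k = coords x k - coords y k := rfl

theorem aux_coords_add (x y : ErdosSpace) (k : ℕ) :
    coords (x + y) k = coords x k + coords y k := rfl

theorem aux_cont (k : ℕ) : Continuous fun x : ErdosSpace => coords x k := by
  have : LipschitzWith 1 fun x : ErdosSpace => coords x k := by
    refine LipschitzWith.of_dist_le_mul fun x y => ?_
    rw [Real.dist_eq, ← aux_coords_sub, dist_eq_norm]
    simpa using aux_coord_le (x - y) k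
  exact this.continuous

theorem aux_cont_sum (m : ℕ) :
    Continuous fun x : ErdosSpace => ∑ k ∈ Finset.range m, (coords x k) ^ 2 :=
  continuous_finsetSum _ fun k _ => (aux_cont k).pow 2

theorem aux_rat (x : ErdosSpace) (k : ℕ) : ∃ q : ℚ, coords x k = q := x.2 k

theorem aux_rat_sum (x : ErdosSpace) (m : ℕ) :
    ∃ q : ℚ, ∑ k ∈ Finset.range m, (coords x k) ^ 2 = q := by
  choose q hq using aux_rat x
  exact ⟨∑ k ∈ Finset.range m, q k ^ 2, by push_cast; simp [hq]⟩

/-- bad points at level `(a, b)` -/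
def badSet (a b : ℝ) : Set ErdosSpace :=
  {x | ∃ m l : ℕ, m ≤ l ∧ a < ∑ k ∈ Finset.range m, (coords x k) ^ 2 ∧ b < |coords x l|}

theorem aux_bad_open (a b : ℝ) : IsOpen (badSet a b) := by
  have : badSet a b = ⋃ (m : ℕ) (l : ℕ) (_ : m ≤ l),
      ({x | a < ∑ k ∈ Finset.range m, (coords x k) ^ 2} ∩ {x | b < |coords x l|}) := by
    ext x
    simp only [badSet, Set.mem_setOf_eq, Set.mem_iUnion, Set.mem_inter_iff, exists_prop]
  rw [this]
  refine isOpen_iUnion fun m => isOpen_iUnion fun l => isOpen_iUnion fun _ => ?_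
  exact (isOpen_lt continuous_const (aux_cont_sum m)).inter
    (isOpen_lt continuous_const (aux_cont l).abs)

open Filter Topology in
theorem aux_bad_closed (a b : ℝ) (ha0 : 0 < a) (hb0 : 0 < b) (ha : Irrational a)
    (hb : Irrational b) (x : ErdosSpace) (hx : x ∉ badSet a b) :
    ∀ᶠ y in 𝓝 x, y ∉ badSet a b := by
  by_cases hE : ∃ m : ℕ, a < ∑ k ∈ Finset.range m, (coords x k) ^ 2
  · classical
    have hm := Nat.find_spec hE
    have hmin := fun n => @Nat.find_min _ _ hE n
    generalize Nat.find hE = m0 at hm hmin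
    have hle : ∀ l, m0 ≤ l → |coords x l| < b := by
      intro l hl
      have h1 : |coords x l| ≤ b := by
        by_contra! hc
        exact hx ⟨m0, l, hl, hm, hc⟩
      refine lt_of_le_of_ne h1 fun h => hb ?_
      obtain ⟨q, hq⟩ := aux_rat x l
      exact ⟨|q|, by rw [← h, hq]; simp⟩
    obtain ⟨p, rfl⟩ : ∃ p, m0 = p + 1 := by
      cases m0 with
      | zero => simp at hm; linarith
      | succ p => exact ⟨p, rfl⟩
    have hlt : ∑ k ∈ Finset.range p, (coords x k) ^ 2 < a := by
      refine lt_of_le_of_ne (not_lt.1 (hmin p (by omega))) fun h => ha ?_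
      obtain ⟨q, hq⟩ := aux_rat_sum x p
      exact ⟨q, by rw [← h, hq]⟩
    have h1 : ∀ᶠ y in 𝓝 x, ∑ k ∈ Finset.range p, (coords y k) ^ 2 < a :=
      (aux_cont_sum p).continuousAt.eventually_lt continuousAt_const hlt
    have h2 : Tendsto (fun k => (coords x k) ^ 2) atTop (𝓝 0) :=
      (aux_hasSum x).summable.tendsto_atTop_zero
    obtain ⟨N, hN⟩ := eventually_atTop.1
      (h2.eventually_lt_const (show (0:ℝ) < (b/2)^2 by positivity))
    have h3 : ∀ᶠ y in 𝓝 x, ∀ l ∈ Finset.range N, p + 1 ≤ l → |coords y l| < b := by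
      rw [Filter.eventually_all_finset]
      intro l _
      by_cases hl : p + 1 ≤ l
      · have := (aux_cont l).abs.continuousAt.eventually_lt
          (continuousAt_const (y := b)) (hle l hl)
        filter_upwards [this] with y hy _ using hy
      · exact Eventually.of_forall fun y h => absurd h hl
    filter_upwards [h1, h3, Metric.ball_mem_nhds x (half_pos hb0)] with y y1 y3 y4
    rintro ⟨m, l, hml, hma, hlb⟩
    have hpm : p + 1 ≤ m := by
      by_contra! hc
      have : ∑ k ∈ Finset.range m, (coords y k) ^ 2 ≤ ∑ k ∈ Finset.range p, (coords y k) ^ 2 :=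
        Finset.sum_le_sum_of_subset_of_nonneg (Finset.range_mono (by omega))
          fun _ _ _ => sq_nonneg _
      linarith
    by_cases hlN : l < N
    · have := y3 l (Finset.mem_range.2 hlN) (by omega)
      linarith
    · have e1 := abs_lt_of_sq_lt_sq (hN l (by omega)) (by positivity)
      have e2 := aux_coord_le (y - x) l
      rw [aux_coords_sub] at e2
      rw [Metric.mem_ball, dist_eq_norm] at y4
      have e3 : |coords y l| ≤ |coords y l - coords x l| + |coords x l| := by
        simpa using abs_add_le (coords y l - coords x l) (coords x l)
      linarith
  · have hn : ‖x‖ ^ 2 ≤ a := by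
      by_contra! hc
      exact hE (aux_exists x a hc)
    have h1 : ∀ᶠ y in 𝓝 x, ‖y‖ ^ 2 < a + b ^ 2 :=
      (continuous_norm.pow 2).continuousAt.eventually_lt continuousAt_const
        (show ‖x‖ ^ 2 < a + b ^ 2 by have : 0 < b ^ 2 := by positivity
                                     linarith)
    filter_upwards [h1] with y hy
    rintro ⟨m, l, hml, hma, hlb⟩
    have h := aux_sum_le y (insert l (Finset.range m))
    rw [Finset.sum_insert (by simp; omega)] at h
    have : b ^ 2 < coords y l ^ 2 := by
      rw [← sq_abs (coords y l)]
      exact pow_lt_pow_left₀ hlb hb0.le (by norm_num)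
    linarith

/-- The clopen neighbourhood of zero. -/
def goodSet : Set ErdosSpace :=
  {x | ∀ n : ℕ, x ∉ badSet (√2 + n) (√2 / ((n + 1 : ℕ) : ℝ))}

open Filter Topology in
theorem aux_good_clopen : IsClopen goodSet := by
  constructor
  · have : goodSet = ⋂ n : ℕ, (badSet (√2 + n) (√2 / ((n + 1 : ℕ) : ℝ)))ᶜ := by
      ext x; simp [goodSet]
    rw [this]
    exact isClosed_iInter fun n => (aux_bad_open _ _).isClosed_compl
  · rw [isOpen_iff_mem_nhds]
    intro x hx
    obtain ⟨N, hN⟩ := exists_nat_gt (‖x‖ ^ 2)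
    have h1 : ∀ᶠ y in 𝓝 x, ‖y‖ ^ 2 < N :=
      (continuous_norm.pow 2).continuousAt.eventually_lt continuousAt_const hN
    have h2 : ∀ᶠ y in 𝓝 x, ∀ n ∈ Finset.range N,
        y ∉ badSet (√2 + n) (√2 / ((n + 1 : ℕ) : ℝ)) := by
      rw [Filter.eventually_all_finset]
      intro n _
      exact aux_bad_closed _ _ (by positivity) (by positivity) (irrational_sqrt_two.add_natCast n)
        (irrational_sqrt_two.div_natCast (by omega)) x (hx n)
    filter_upwards [h1, h2] with y y1 y2 n
    by_cases hn : n < N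
    · exact y2 n (Finset.mem_range.2 hn)
    · rintro ⟨m, l, hml, hma, hlb⟩
      have h := aux_sum_le y (Finset.range m)
      have : (N : ℝ) ≤ n := by exact_mod_cast not_lt.1 hn
      have : 0 < √2 := by positivity
      linarith

theorem aux_zero_good : (0 : ErdosSpace) ∈ goodSet := by
  rintro n ⟨m, l, -, -, h⟩
  have h0 : coords 0 l = 0 := rfl
  rw [h0, abs_zero] at h
  have : 0 ≤ √2 / ((n + 1 : ℕ) : ℝ) := by positivity
  linarith

/-- basis vectors -/
def evec (n : ℕ) (q : ℚ) : ErdosSpace := ⟨lp.single 2 n (q : ℝ), fun k => by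
  by_cases h : k = n
  · subst h; exact ⟨q, by simp⟩
  · exact ⟨0, by simp [h]⟩⟩

theorem aux_evec_norm (n : ℕ) (q : ℚ) : ‖evec n q‖ = |(q : ℝ)| := by
  have := lp.norm_single (E := fun _ : ℕ => ℝ) (p := 2) (by simp) n (q : ℝ)
  rw [Real.norm_eq_abs] at this
  exact this

theorem aux_evec_self (n : ℕ) (q : ℚ) : coords (evec n q) n = q := by
  simp [evec, coords]

theorem aux_evec_ne (n : ℕ) (q : ℚ) (k : ℕ) (h : k ≠ n) : coords (evec n q) k = 0 := by
  simp [evec, coords, h]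

theorem aux_evec_add (n : ℕ) (p q : ℚ) : evec n (p + q) = evec n p + evec n q := by
  apply Subtype.ext
  simp [evec]

theorem aux_evec_zero (n : ℕ) : evec n 0 = 0 := by
  apply Subtype.ext
  simp [evec]

theorem aux_step (W : Set ErdosSpace) (R : ℝ) (hR : ∀ x ∈ W, ‖x‖ ≤ R) (w : ErdosSpace)
    (hw : w ∈ W) (n : ℕ) :
    ∃ q : ℚ, w + evec n q ∈ W ∧ w + evec n q + evec n (1 / (n + 1)) ∉ W := by
  by_contra! hc
  have hall : ∀ k : ℕ, w + evec n (k * (1 / (n + 1))) ∈ W := by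
    intro k
    induction k with
    | zero => simpa [aux_evec_zero] using hw
    | succ k ih =>
      have := hc _ ih
      rw [add_assoc, ← aux_evec_add] at this
      convert this using 3
      push_cast; ring
  obtain ⟨k, hk⟩ := exists_nat_gt ((R + ‖w‖) * (n + 1))
  have h1 := hR _ (hall k)
  have h2 : ‖evec n (k * (1 / (n + 1)))‖ ≤ ‖w + evec n (k * (1 / (n + 1)))‖ + ‖w‖ := by
    simpa using norm_sub_le (w + evec n (k * (1 / (n + 1)))) w
  rw [aux_evec_norm] at h2
  have h3 : R + ‖w‖ < (k : ℝ) * (1 / (n + 1)) := by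
    rw [mul_one_div, lt_div_iff₀ (by positivity)]
    exact hk
  have h4 := le_abs_self (((k * (1 / (n + 1)) : ℚ)) : ℝ)
  push_cast at h2 h4
  linarith

open Filter Topology in
theorem aux_unbounded (W : Set ErdosSpace) (hW : IsClopen W) (h0 : 0 ∈ W) (R : ℝ) :
    ∃ x ∈ W, R < ‖x‖ := by
  by_contra! hR
  choose! Q hQ1 hQ2 using aux_step W R hR
  let X : ℕ → ErdosSpace := fun n => Nat.rec 0 (fun n w => w + evec n (Q w n)) n
  have hXs : ∀ n, X (n + 1) = X n + evec n (Q (X n) n) := fun n => rfl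
  have hX : ∀ n, X n ∈ W := by
    intro n
    induction n with
    | zero => exact h0
    | succ n ih => rw [hXs]; exact hQ1 _ ih n
  let q : ℕ → ℚ := fun n => Q (X n) n
  have hsum : ∀ n, (X n).1 = ∑ k ∈ Finset.range n, lp.single 2 k ((q k : ℝ)) := by
    intro n
    induction n with
    | zero => rfl
    | succ n ih => rw [Finset.sum_range_succ, ← ih, hXs]; rfl
  have hR0 : 0 ≤ R := (norm_nonneg _).trans (hR 0 h0)
  have hmem : Memℓp (fun k => (q k : ℝ)) 2 := by
    refine memℓp_gen' (C := R ^ 2) fun s => ?_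
    obtain ⟨n, hn⟩ := s.exists_nat_subset_range
    refine (Finset.sum_le_sum_of_subset_of_nonneg hn fun _ _ _ => by positivity).trans ?_
    rw [← lp.norm_sum_single (p := 2) (E := fun _ : ℕ => ℝ) (by simp) (fun k => (q k : ℝ)),
      ← hsum]
    have h1 : ‖(X n).1‖ ≤ R := hR _ (hX n)
    have h2 : ‖(X n).1‖ ^ 2 ≤ R ^ 2 := pow_le_pow_left₀ (norm_nonneg _) h1 2
    simpa using h2
  let z : ErdosSpace := ⟨⟨fun k => (q k : ℝ), hmem⟩, fun k => ⟨q k, rfl⟩⟩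
  have hlim : Tendsto X atTop (𝓝 z) := by
    rw [tendsto_subtype_rng]
    have := (lp.hasSum_single (p := 2) (by simp) (z : ellTwo)).tendsto_sum_nat
    refine this.congr fun n => ?_
    rw [hsum]
  have hz : z ∈ W := hW.1.mem_of_tendsto hlim (Eventually.of_forall hX)
  have he : Tendsto (fun n : ℕ => evec n (1 / (n + 1))) atTop (𝓝 0) := by
    rw [tendsto_zero_iff_norm_tendsto_zero]
    refine tendsto_one_div_add_atTop_nhds_zero_nat.congr fun n => ?_
    rw [aux_evec_norm]
    push_cast
    rw [abs_of_nonneg (by positivity)]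
  have hlim2 := (hlim.comp (tendsto_add_atTop_nat 1)).add he
  rw [add_zero] at hlim2
  have hz2 : z ∈ Wᶜ := hW.2.isClosed_compl.mem_of_tendsto hlim2
    (Eventually.of_forall fun n => hQ2 _ (hX n) n)
  exact hz2 hz

open Filter Topology in
theorem aux_main (W₁ W₂ : Set ErdosSpace) (h₁ : IsClopen W₁) (h₂ : IsClopen W₂) (z₁ : 0 ∈ W₁)
    (z₂ : 0 ∈ W₂) : ∃ x ∈ W₁, ∃ y ∈ W₂, x + y ∉ goodSet := by
  obtain ⟨δ, hδ, hball⟩ := Metric.isOpen_iff.1 h₂.2 0 z₂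
  obtain ⟨n, hn⟩ := exists_nat_gt (√2 / δ)
  have hn' : √2 / ((n + 1 : ℕ) : ℝ) < δ := by
    rw [div_lt_iff₀ hδ] at hn
    rw [div_lt_iff₀ (by positivity)]
    push_cast
    nlinarith
  obtain ⟨q, hq1, hq2⟩ := exists_rat_btwn hn'
  have hq0 : (0 : ℝ) < q := lt_of_le_of_lt (by positivity) hq1
  obtain ⟨x, hxW, hx⟩ := aux_unbounded W₁ h₁ z₁ (√2 + n + 1)
  have hs : 0 < √2 := by positivity
  have hx2 : √2 + n < ‖x‖ ^ 2 := by
    have : (0 : ℝ) ≤ n := by positivity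
    nlinarith
  obtain ⟨m, hm⟩ := aux_exists x _ hx2
  have key : ∀ r : ℚ, |r| = q → √2 / ((n + 1 : ℕ) : ℝ) < |coords x m + r| →
      ∃ x ∈ W₁, ∃ y ∈ W₂, x + y ∉ goodSet := by
    intro r hr hr2
    refine ⟨x, hxW, evec m r, hball ?_, fun hg => hg n ⟨m, m, le_rfl, ?_, ?_⟩⟩
    · rw [mem_ball_zero_iff, aux_evec_norm, ← Rat.cast_abs, hr]
      exact hq2
    · refine hm.trans_eq (Finset.sum_congr rfl fun k hk => ?_)
      rw [aux_coords_add, aux_evec_ne _ _ _ (Finset.mem_range.1 hk).ne, add_zero]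
    · rw [aux_coords_add, aux_evec_self]; exact hr2
  have hq0' : 0 < q := by exact_mod_cast hq0
  rcases le_total 0 (coords x m) with h | h
  · refine key q (abs_of_pos hq0') ?_
    rw [abs_of_nonneg (by linarith)]; linarith
  · refine key (-q) (by rw [abs_neg, abs_of_pos hq0']) ?_
    rw [Rat.cast_neg, abs_of_nonpos (by linarith)]; linarith

/-- The topology on Erdős space generated by the clopen subsets of the norm topology
is not compatible with the group structure: addition fails to be continuous for it. -/
theorem erdos_clopen_topology_not_compatible :
    ¬ @ContinuousAdd ErdosSpace
        (TopologicalSpace.generateFrom {U : Set ErdosSpace | IsClopen U})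
        inferInstance := by
  intro hc
  have hb := aux_clopen_basis
  let t : TopologicalSpace ErdosSpace :=
    TopologicalSpace.generateFrom {U : Set ErdosSpace | IsClopen U}
  have hU : @IsOpen _ t goodSet := @TopologicalSpace.IsTopologicalBasis.isOpen _ t _ _ hb aux_good_clopen
  have hadd : @Continuous (ErdosSpace × ErdosSpace) ErdosSpace (@instTopologicalSpaceProd _ _ t t) t
    (fun p => p.1 + p.2) := @ContinuousAdd.continuous_add _ t _ hc
  have hp := (@Continuous.isOpen_preimage _ _ (@instTopologicalSpaceProd _ _ t t) t _ hadd _ hU)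
  obtain ⟨V₁, V₂, o₁, o₂, z₁, z₂, hV⟩ := (@isOpen_prod_iff _ _ t t _).1 hp 0 0
    (by simpa using aux_zero_good)
  obtain ⟨W₁, c₁, y₁, s₁⟩ :=
    @TopologicalSpace.IsTopologicalBasis.exists_subset_of_mem_open _ t _ hb _ _ z₁ o₁
  obtain ⟨W₂, c₂, y₂, s₂⟩ :=
    @TopologicalSpace.IsTopologicalBasis.exists_subset_of_mem_open _ t _ hb _ _ z₂ o₂
  obtain ⟨x, hx, y, hy, hxy⟩ := aux_main W₁ W₂ c₁ c₂ y₁ y₂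
  exact hxy (hV (Set.mk_mem_prod (s₁ hx) (s₂ hy)))
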